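/- For every s>1/2 there is a constant C depending only on s such that for every ψ∈H^s(𝕋[0,2π]) the commutator [ℋ,ψ] is a bounded operator from H¹(𝕋[0,2π]) to H^s(𝕋[0,2π]), with ‖[ℋ,ψ]f‖_s ≤ C‖f‖₁‖ψ‖_s for all f∈H¹(𝕋[0,2π]). -/

import Mathlib

open MeasureTheory Complex Filter
open scoped Real BigOperators

noncomputable section

namespace HeleShaw

/-- k-th Fourier coefficient of a 2π-periodic function `f : ℝ → ℂ`. -/
def fc (f : ℝ → ℂ) (k : ℤ) : ℂ :=
  (1 / (2 * (π : ℂ))) * ∫ α in (0:ℝ)..(2*π), f α * Complex.exp (-Complex.I * (k:ℂ) * (α:ℂ))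

/-- Square of the Sobolev `H^s` norm, via Fourier coefficients. -/
def hnormSq (s : ℝ) (f : ℝ → ℂ) : ℝ :=
  (∑' k : ℤ, |(k:ℝ)| ^ (2*s) * ‖fc f k‖^2) + ‖fc f 0‖^2

/-- The Sobolev `H^s` norm. -/
def hnorm (s : ℝ) (f : ℝ → ℂ) : ℝ := Real.sqrt (hnormSq s f)

/-- Membership in `H^s(𝕋[0,2π])`. -/
def MemH (s : ℝ) (f : ℝ → ℂ) : Prop :=
  Function.Periodic f (2*π) ∧ IntervalIntegrable f volume 0 (2*π) ∧
    Summable (fun k : ℤ => |(k:ℝ)| ^ (2*s) * ‖fc f k‖^2)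

/-- Real-valued function. -/
def IsRealFn (f : ℝ → ℂ) : Prop := ∀ α, (f α).im = 0

/-- The projection 𝒬₁ removing Fourier modes `0, ±1`. -/
def Q1 (f : ℝ → ℂ) (α : ℝ) : ℂ :=
  f α - fc f 0 - fc f 1 * Complex.exp (Complex.I * (α:ℂ))
    - fc f (-1) * Complex.exp (-Complex.I * (α:ℂ))

/-- Membership in `Ḣ^s`: real valued `H^s` functions fixed by 𝒬₁. -/
def MemHdot (s : ℝ) (f : ℝ → ℂ) : Prop :=
  MemH s f ∧ IsRealFn f ∧ fc f 0 = 0 ∧ fc f 1 = 0 ∧ fc f (-1) = 0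

/-- The Hilbert transform, via Fourier multipliers `-i sgn k`. -/
def HT (f : ℝ → ℂ) (α : ℝ) : ℂ :=
  ∑' k : ℤ, (-Complex.I) * (Int.sign k : ℂ) * fc f k * Complex.exp (Complex.I * (k:ℂ) * (α:ℂ))

/-- The commutator `[ℋ, ψ] f = ℋ(ψ f) - ψ ℋ(f)`. -/
def commHT (ψ f : ℝ → ℂ) (α : ℝ) : ℂ :=
  HT (fun β => ψ β * f β) α - ψ α * HT f α

/-- Real cotangent. -/
def rcot (x : ℝ) : ℝ := Real.cos x / Real.sin x

/-- The integral operator 𝒦[z]. -/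
def Kop (z f : ℝ → ℂ) (α : ℝ) : ℂ :=
  (1 / (2 * (π:ℂ) * Complex.I)) *
    ∫ β in (α - π)..(α + π),
      f β * (1 / (z α - z β) - 1 / (2 * deriv z β) * (rcot ((α - β)/2) : ℂ))

/-- The operator 𝒢[z]f = z_α [ℋ, 1/z_α] f + 2 i z_α 𝒦[z] f. -/
def Gop (z f : ℝ → ℂ) (α : ℝ) : ℂ :=
  deriv z α * commHT (fun β => 1 / deriv z β) f α + 2 * Complex.I * deriv z α * Kop z f α

/-- The operator ℱ[z]f = Re((1/i) 𝒢[z] f). -/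
def Fop (z f : ℝ → ℂ) (α : ℝ) : ℝ := (Gop z f α / Complex.I).re

/-- The curve ω determined by θ̃ and `c = θ̂(1)` (with `θ̂(-1) = conj c`). -/
def omegaCurve (θt : ℝ → ℂ) (c : ℂ) (α : ℝ) : ℂ :=
  ∫ τ in (0:ℝ)..α,
    Complex.exp (Complex.I * (τ:ℂ) + Complex.I * c * Complex.exp (Complex.I * (τ:ℂ))
      + Complex.I * (starRingEnd ℂ c) * Complex.exp (-Complex.I * (τ:ℂ)) + Complex.I * θt τ)

/-- θ = θ̃ + θ̂(1) e^{iα} + θ̂(-1) e^{-iα}. -/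
def thetaFull (θt : ℝ → ℂ) (c : ℂ) (α : ℝ) : ℂ :=
  θt α + c * Complex.exp (Complex.I * (α:ℂ))
    + (starRingEnd ℂ c) * Complex.exp (-Complex.I * (α:ℂ))

/-- The constraint (B.4). -/
def ConstraintB4 (θt : ℝ → ℂ) (c : ℂ) : Prop :=
  (∫ α in (0:ℝ)..(2*π),
    Complex.exp (Complex.I * (α:ℂ)
      + Complex.I * ((starRingEnd ℂ c) * Complex.exp (-Complex.I * (α:ℂ))
          + c * Complex.exp (Complex.I * (α:ℂ)) + θt α))) = 0

/-- The vortex sheet strength equation `(I + A_μ ℱ[ω]) γ = (2πσ/L) θ_αα`. -/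
def GammaRel (σ L Aμ : ℝ) (θt : ℝ → ℂ) (c : ℂ) (γ : ℝ → ℂ) : Prop :=
  ∀ α, γ α + (Aμ:ℂ) * ((Fop (omegaCurve θt c) γ α : ℝ) : ℂ)
      = ((2*π*σ/L : ℝ) : ℂ) * deriv (deriv (thetaFull θt c)) α

/-- The normal velocity `U = (π/L) ℋγ + (π/L) Re(𝒢[ω]γ)`. -/
def Ufn (L : ℝ) (ω γ : ℝ → ℂ) (α : ℝ) : ℂ :=
  ((π/L : ℝ) : ℂ) * HT γ α + ((π/L : ℝ) : ℂ) * ((Gop ω γ α).re : ℂ)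

/-- The tangential velocity `T`. -/
def Tfn (θ U : ℝ → ℂ) (α : ℝ) : ℂ :=
  (∫ β in (0:ℝ)..α, (1 + deriv θ β) * U β)
    - ((α/(2*π) : ℝ) : ℂ) * ∫ β in (0:ℝ)..(2*π), (1 + deriv θ β) * U β

/-- Galerkin projection `P_n`, keeping modes `2 ≤ |k| ≤ n`. -/
def Pn (n : ℕ) (f : ℝ → ℂ) (α : ℝ) : ℂ :=
  ∑ k ∈ Finset.Icc (-(n:ℤ)) (n:ℤ),
    if 2 ≤ |k| then fc f k * Complex.exp (Complex.I * (k:ℂ) * (α:ℂ)) else 0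

/-- `z_α = (L/(2π)) e^{i(α+θ)}`. -/
def zDeriv (L : ℝ) (θ : ℝ → ℂ) (α : ℝ) : ℂ :=
  ((L/(2*π) : ℝ) : ℂ) * Complex.exp (Complex.I * ((α:ℂ) + θ α))

/-- The curve `z` with `z(0)=0` and `z_α = (L/(2π)) e^{i(α+θ)}`. -/
def zCurve (L : ℝ) (θ : ℝ → ℂ) (α : ℝ) : ℂ := ∫ τ in (0:ℝ)..α, zDeriv L θ τ

/-- Area enclosed by the curve: `S = (1/2) Im ∫₀^{2π} z_α z* dα`. -/
def areaF (L : ℝ) (θ : ℝ → ℂ) : ℝ :=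
  (1/2) * (∫ α in (0:ℝ)..(2*π), zDeriv L θ α * (starRingEnd ℂ) (zCurve L θ α)).im

/-- Divided difference `q₁[ω](α,α') = ∫₀¹ ω_α(tα+(1-t)α') dt`. -/
def q1 (ω : ℝ → ℂ) (α β : ℝ) : ℂ := ∫ t in (0:ℝ)..1, deriv ω (t*α + (1-t)*β)

/-- Divided difference `q₂[ω](α,α') = ∫₀¹ (t-1) ω_αα((1-t)α + tα') dt`. -/
def q2 (ω : ℝ → ℂ) (α β : ℝ) : ℂ :=
  ∫ t in (0:ℝ)..1, ((t:ℂ) - 1) * deriv (deriv ω) ((1-t)*α + t*β)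

/-- System (A.1)-(A.2) at time `t`. -/
def SystemA (σ Aμ : ℝ) (θ : ℝ → ℝ → ℂ) (L : ℝ → ℝ) (γ : ℝ → ℝ → ℂ) (t : ℝ) : Prop :=
  (∀ α, γ t α + (Aμ:ℂ) * ((Fop (zCurve (L t) (θ t)) (γ t) α : ℝ) : ℂ)
      = ((2*π*σ/(L t) : ℝ) : ℂ) * deriv (deriv (θ t)) α) ∧
  (∀ α, deriv (fun τ => θ τ α) t
      = ((2*π/(L t) : ℝ) : ℂ) * (deriv (Ufn (L t) (zCurve (L t) (θ t)) (γ t)) α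
        + Tfn (θ t) (Ufn (L t) (zCurve (L t) (θ t)) (γ t)) α * (1 + deriv (θ t) α))) ∧
  deriv L t = -(∫ α in (0:ℝ)..(2*π),
      ((1 + deriv (θ t) α) * Ufn (L t) (zCurve (L t) (θ t)) (γ t) α)).re

/-- The Galerkin system (C.1)-(C.2) at time `t`. -/
def GalerkinSystem (n : ℕ) (σ Aμ : ℝ) (θt : ℝ → ℝ → ℂ) (Ln : ℝ → ℝ)
    (c : ℝ → ℂ) (γ : ℝ → ℝ → ℂ) (t : ℝ) : Prop :=
  ConstraintB4 (θt t) (c t) ∧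
  fc (γ t) 0 = 0 ∧
  GammaRel σ (Ln t) Aμ (θt t) (c t) (γ t) ∧
  (∀ α, deriv (fun τ => θt τ α) t
     = ((2*π/(Ln t) : ℝ) : ℂ) * Pn n (fun β =>
         deriv (Ufn (Ln t) (omegaCurve (θt t) (c t)) (γ t)) β
         + Tfn (thetaFull (θt t) (c t)) (Ufn (Ln t) (omegaCurve (θt t) (c t)) (γ t)) β
           * (1 + deriv (thetaFull (θt t) (c t)) β)) α) ∧
  deriv Ln t = -(∫ α in (0:ℝ)..(2*π),
     ((1 + deriv (thetaFull (θt t) (c t)) α)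
       * Ufn (Ln t) (omegaCurve (θt t) (c t)) (γ t) α)).re

/-- System (B.1),(B.3),(B.4) at time `t`. -/
def SystemB (σ Aμ : ℝ) (θt : ℝ → ℝ → ℂ) (L : ℝ → ℝ)
    (c : ℝ → ℂ) (γ : ℝ → ℝ → ℂ) (t : ℝ) : Prop :=
  ConstraintB4 (θt t) (c t) ∧
  fc (γ t) 0 = 0 ∧
  GammaRel σ (L t) Aμ (θt t) (c t) (γ t) ∧
  (∀ α, deriv (fun τ => θt τ α) t
     = ((2*π/(L t) : ℝ) : ℂ) * Q1 (fun β =>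
         deriv (Ufn (L t) (omegaCurve (θt t) (c t)) (γ t)) β
         + Tfn (thetaFull (θt t) (c t)) (Ufn (L t) (omegaCurve (θt t) (c t)) (γ t)) β
           * (1 + deriv (thetaFull (θt t) (c t)) β)) α) ∧
  deriv L t = -(∫ α in (0:ℝ)..(2*π),
     ((1 + deriv (thetaFull (θt t) (c t)) α)
       * Ufn (L t) (omegaCurve (θt t) (c t)) (γ t) α)).re

/-- Membership in the ball 𝓑 of radius ε in `Ḣ^r`. -/
def InBall (r ε : ℝ) (u : ℝ → ℂ) : Prop := MemHdot r u ∧ hnorm r u < ε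

/-- Membership in 𝓥. -/
def InV (r ε : ℝ) (u : ℝ → ℂ) (v : ℝ) : Prop := InBall r ε u ∧ |v - 2*π| < 1


/-- Cauchy–Schwarz inequality for series of nonnegative reals. -/
theorem summable_mul_and_sq_tsum_mul_le {ι : Type*} {x y : ι → ℝ} (hx : ∀ i, 0 ≤ x i)
    (hy : ∀ i, 0 ≤ y i) (hx2 : Summable fun i => x i ^ 2) (hy2 : Summable fun i => y i ^ 2) :
    Summable (fun i => x i * y i) ∧
      (∑' i, x i * y i) ^ 2 ≤ (∑' i, x i ^ 2) * ∑' i, y i ^ 2 := by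
  have h22 : (2 : ℝ).HolderConjugate 2 := Real.HolderConjugate.two_two
  obtain ⟨h1, h2⟩ := Real.summable_and_inner_le_Lp_mul_Lq_tsum_of_nonneg h22 hx hy
    (by simpa using hx2) (by simpa using hy2)
  refine ⟨h1, ?_⟩
  simp only [Real.rpow_two, ← Real.sqrt_eq_rpow] at h2
  calc (∑' i, x i * y i) ^ 2 ≤ (√(∑' i, x i ^ 2) * √(∑' i, y i ^ 2)) ^ 2 :=
        pow_le_pow_left₀ (tsum_nonneg fun i => mul_nonneg (hx i) (hy i)) h2 2
    _ = _ := by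
        rw [mul_pow, Real.sq_sqrt (tsum_nonneg fun i => sq_nonneg _),
          Real.sq_sqrt (tsum_nonneg fun i => sq_nonneg _)]

/-- The shear `(k, j) ↦ (k - j, j)` of `ℤ × ℤ`. -/
def shear : ℤ × ℤ ≃ ℤ × ℤ where
  toFun p := (p.1 - p.2, p.2)
  invFun p := (p.1 + p.2, p.2)
  left_inv p := by simp
  right_inv p := by simp

theorem hasSum_shear_mul {u v : ℤ → ℝ} (hu : ∀ i, 0 ≤ u i) (hv : ∀ i, 0 ≤ v i)
    (hus : Summable u) (hvs : Summable v) :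
    HasSum (fun p : ℤ × ℤ => u (p.1 - p.2) * v p.2) ((∑' i, u i) * ∑' i, v i) := by
  have h := hus.mul_of_nonneg hvs hu hv
  have h' := hus.hasSum.mul hvs.hasSum h
  exact shear.hasSum_iff.mpr h'

theorem summable_sub_mul {u v : ℤ → ℝ} (hu : ∀ i, 0 ≤ u i) (hv : ∀ i, 0 ≤ v i)
    (hus : Summable u) (hvs : Summable v) (k : ℤ) : Summable fun j => u (k - j) * v j :=
  (hasSum_shear_mul hu hv hus hvs).summable.prod_factor k

theorem hasSum_tsum_sub_mul {u v : ℤ → ℝ} (hu : ∀ i, 0 ≤ u i) (hv : ∀ i, 0 ≤ v i)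
    (hus : Summable u) (hvs : Summable v) :
    HasSum (fun k => ∑' j, u (k - j) * v j) ((∑' i, u i) * ∑' i, v i) :=
  (hasSum_shear_mul hu hv hus hvs).prod_fiberwise
    fun k => (summable_sub_mul hu hv hus hvs k).hasSum

/-- Young's inequality `ℓ² * ℓ¹ ⊆ ℓ²` for convolution of nonnegative sequences on `ℤ`. -/
theorem young_conv {u v : ℤ → ℝ} (hu : ∀ i, 0 ≤ u i) (hv : ∀ i, 0 ≤ v i)
    (hus : Summable fun i => u i ^ 2) (hvs : Summable v) :
    (∀ k, Summable fun j => u (k - j) * v j) ∧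
    (Summable fun k => (∑' j, u (k - j) * v j) ^ 2) ∧
      ∑' k, (∑' j, u (k - j) * v j) ^ 2 ≤ (∑' i, u i ^ 2) * (∑' i, v i) ^ 2 := by
  have hu2 : ∀ i, 0 ≤ u i ^ 2 := fun i => sq_nonneg _
  have e1 : ∀ k j, (u (k - j) * √(v j)) ^ 2 = u (k - j) ^ 2 * v j := fun k j => by
    rw [mul_pow, Real.sq_sqrt (hv j)]
  have e2 : ∀ j, √(v j) ^ 2 = v j := fun j => Real.sq_sqrt (hv j)
  have e3 : ∀ k j, (u (k - j) * √(v j)) * √(v j) = u (k - j) * v j := fun k j => by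
    rw [mul_assoc, Real.mul_self_sqrt (hv j)]
  have cs : ∀ k, Summable (fun j => u (k - j) * v j) ∧
      (∑' j, u (k - j) * v j) ^ 2 ≤ (∑' j, u (k - j) ^ 2 * v j) * ∑' j, v j := by
    intro k
    have := summable_mul_and_sq_tsum_mul_le (x := fun j => u (k - j) * √(v j))
      (y := fun j => √(v j)) (fun j => mul_nonneg (hu _) (Real.sqrt_nonneg _))
      (fun j => Real.sqrt_nonneg _)
      (by simpa only [e1] using summable_sub_mul hu2 hv hus hvs k) (by simpa only [e2] using hvs)
    simpa only [e1, e2, e3] using this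
  have hd := (hasSum_tsum_sub_mul hu2 hv hus hvs).mul_right (∑' j, v j)
  have hs := Summable.of_nonneg_of_le (fun k => sq_nonneg _) (fun k => (cs k).2) hd.summable
  refine ⟨fun k => (cs k).1, hs, ?_⟩
  calc _ ≤ _ := hs.tsum_le_tsum (fun k => (cs k).2) hd.summable
    _ = _ := by rw [hd.tsum_eq]; ring

/-- For `s > 1/2`, a sequence in the weighted space `ℓ²(|k|^{2s})` is absolutely summable. -/
theorem exists_sq_tsum_norm_le {s : ℝ} (hs : 1 / 2 < s) :
    ∃ W : ℝ, 0 < W ∧ ∀ a : ℤ → ℂ, Summable (fun k : ℤ => |(k : ℝ)| ^ (2 * s) * ‖a k‖ ^ 2) →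
      Summable (fun k => ‖a k‖) ∧
        (∑' k, ‖a k‖) ^ 2 ≤ W * ((∑' k : ℤ, |(k : ℝ)| ^ (2 * s) * ‖a k‖ ^ 2) + ‖a 0‖ ^ 2) := by
  have h0 : Summable (Pi.single (M := fun _ : ℤ => ℝ) 0 1) := (hasSum_pi_single 0 1).summable
  have hw := (Real.summable_abs_int_rpow (b := 2 * s) (by linarith)).add h0
  set w : ℤ → ℝ := fun k => |(k : ℝ)| ^ (-(2 * s)) + Pi.single (M := fun _ : ℤ => ℝ) 0 1 k
  have hs0 : 2 * s ≠ 0 := by linarith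
  have w0 : w 0 = 1 := by simp [w, Real.zero_rpow (neg_ne_zero.mpr hs0)]
  have w1 : ∀ k : ℤ, k ≠ 0 → w k = (|(k : ℝ)| ^ (2 * s))⁻¹ := fun k hk => by
    simp [w, hk, Real.rpow_neg]
  have wpos : ∀ k, 0 < w k := fun k => by
    rcases eq_or_ne k 0 with rfl | hk
    · rw [w0]; exact one_pos
    · rw [w1 k hk]
      have : 0 < |(k : ℝ)| := by simpa using hk
      positivity
  refine ⟨∑' k, w k, hw.tsum_pos (fun k => (wpos k).le) 0 (wpos 0), fun a ha => ?_⟩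
  have hb : HasSum (fun k => (w k)⁻¹ * ‖a k‖ ^ 2)
      ((∑' k : ℤ, |(k : ℝ)| ^ (2 * s) * ‖a k‖ ^ 2) + ‖a 0‖ ^ 2) := by
    have := ha.hasSum.add (hasSum_pi_single (0 : ℤ) (‖a 0‖ ^ 2))
    refine this.congr_fun ?_
    intro k
    rcases eq_or_ne k 0 with rfl | hk
    · simp [w0, Real.zero_rpow hs0]
    · simp [w1 k hk, hk]
  have e1 : ∀ k, √(w k) ^ 2 = w k := fun k => Real.sq_sqrt (wpos k).le
  have e2 : ∀ k, ((√(w k))⁻¹ * ‖a k‖) ^ 2 = (w k)⁻¹ * ‖a k‖ ^ 2 := fun k => by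
    rw [mul_pow, inv_pow, e1]
  have e3 : ∀ k, √(w k) * ((√(w k))⁻¹ * ‖a k‖) = ‖a k‖ := fun k =>
    mul_inv_cancel_left₀ (Real.sqrt_pos.mpr (wpos k)).ne' _
  have := summable_mul_and_sq_tsum_mul_le (x := fun k => √(w k))
    (y := fun k => (√(w k))⁻¹ * ‖a k‖) (fun k => Real.sqrt_nonneg _) (fun k => by positivity)
    (by simpa only [e1] using hw) (by simpa only [e2] using hb.summable)
  simpa only [e1, e2, e3, hb.tsum_eq] using this

/-- The sum of the trigonometric series with coefficients `c`. -/
def fourierSum (c : ℤ → ℂ) (x : ℝ) : ℂ := ∑' k : ℤ, c k * Complex.exp (Complex.I * (k:ℂ) * (x:ℂ))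

theorem norm_exp_I_int_mul (k : ℤ) (x : ℝ) : ‖Complex.exp (Complex.I * (k:ℂ) * (x:ℂ))‖ = 1 := by
  rw [show Complex.I * (k:ℂ) * (x:ℂ) = ((k * x : ℝ) : ℂ) * Complex.I by push_cast; ring,
    Complex.norm_exp_ofReal_mul_I]

theorem norm_exp_neg_I_int_mul (k : ℤ) (x : ℝ) :
    ‖Complex.exp (-Complex.I * (k:ℂ) * (x:ℂ))‖ = 1 := by
  simpa using norm_exp_I_int_mul (-k) x

theorem summable_fourierSum {c : ℤ → ℂ} (hc : Summable fun k => ‖c k‖) (x : ℝ) :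
    Summable fun k : ℤ => c k * Complex.exp (Complex.I * (k:ℂ) * (x:ℂ)) :=
  Summable.of_norm (by simpa only [norm_mul, norm_exp_I_int_mul, mul_one] using hc)

theorem continuous_fourierSum {c : ℤ → ℂ} (hc : Summable fun k => ‖c k‖) :
    Continuous (fourierSum c) :=
  continuous_tsum (fun k => by fun_prop) hc
    fun k x => by rw [norm_mul, norm_exp_I_int_mul, mul_one]

theorem periodic_fourierSum (c : ℤ → ℂ) : Function.Periodic (fourierSum c) (2 * π) := by
  intro x
  unfold fourierSum
  congr 1
  ext k
  congr 1
  rw [show Complex.I * (k:ℂ) * ((x + 2 * π : ℝ):ℂ)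
    = Complex.I * (k:ℂ) * (x:ℂ) + k * (2 * π * Complex.I) by push_cast; ring,
    Complex.exp_add, Complex.exp_int_mul_two_pi_mul_I, mul_one]

theorem intervalIntegrable_mul_fourierSum {ψ : ℝ → ℂ} (hψ : IntervalIntegrable ψ volume 0 (2*π))
    {c : ℤ → ℂ} (hc : Summable fun k => ‖c k‖) :
    IntervalIntegrable (fun x => ψ x * fourierSum c x) volume 0 (2*π) :=
  hψ.mul_continuousOn (continuous_fourierSum hc).continuousOn

theorem hasSum_fc_mul_fourierSum {ψ : ℝ → ℂ} (hψ : IntervalIntegrable ψ volume 0 (2*π))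
    {c : ℤ → ℂ} (hc : Summable fun k => ‖c k‖) (k : ℤ) :
    HasSum (fun j => c j * fc ψ (k - j)) (fc (fun x => ψ x * fourierSum c x) k) := by
  have key : HasSum (fun j : ℤ => ∫ x in (0:ℝ)..(2*π),
      c j * (ψ x * Complex.exp (-Complex.I * ((k - j : ℤ):ℂ) * (x:ℂ))))
      (∫ x in (0:ℝ)..(2*π), ψ x * fourierSum c x * Complex.exp (-Complex.I * (k:ℂ) * (x:ℂ))) := by
    apply intervalIntegral.hasSum_integral_of_dominated_convergence
      (fun j x => ‖c j‖ * ‖ψ x‖)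
    · intro j
      exact ((intervalIntegrable_iff.mp hψ).aestronglyMeasurable.mul
        (Continuous.aestronglyMeasurable (by fun_prop))).const_mul _
    · intro j
      refine ae_of_all _ fun x _ => ?_
      rw [norm_mul, norm_mul, norm_exp_neg_I_int_mul, mul_one]
    · exact ae_of_all _ fun x _ => hc.mul_right _
    · simp_rw [tsum_mul_right]
      exact hψ.norm.const_mul _
    · refine ae_of_all _ fun x _ => ?_
      have := ((summable_fourierSum hc x).hasSum.mul_left (ψ x)).mul_right
        (Complex.exp (-Complex.I * (k:ℂ) * (x:ℂ)))
      refine this.congr_fun fun j => ?_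
      rw [show -Complex.I * ((k - j : ℤ):ℂ) * (x:ℂ)
        = Complex.I * (j:ℂ) * (x:ℂ) + -Complex.I * (k:ℂ) * (x:ℂ) by push_cast; ring,
        Complex.exp_add]
      ring
  have := key.mul_left (1 / (2 * (π : ℂ)))
  refine this.congr_fun fun j => ?_
  rw [intervalIntegral.integral_const_mul, fc]
  ring

theorem fc_one (k : ℤ) : fc (fun _ => 1) k = if k = 0 then 1 else 0 := by
  have hπ : (π : ℂ) ≠ 0 := by exact_mod_cast Real.pi_ne_zero
  unfold fc
  split_ifs with h
  · subst h
    simp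
    field_simp
  · have hk : -Complex.I * (k:ℂ) ≠ 0 := by simp [h]
    simp_rw [one_mul]
    rw [integral_exp_mul_complex hk]
    rw [show -Complex.I * (k:ℂ) * ((2 * π : ℝ) : ℂ) = ((-k : ℤ) : ℂ) * (2 * π * Complex.I) by
      push_cast; ring, Complex.exp_int_mul_two_pi_mul_I]
    simp

theorem fc_fourierSum {c : ℤ → ℂ} (hc : Summable fun k => ‖c k‖) (k : ℤ) :
    fc (fourierSum c) k = c k := by
  have h := hasSum_fc_mul_fourierSum (ψ := fun _ => 1) intervalIntegrable_const hc k
  simp only [one_mul, fc_one] at h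
  refine h.unique ?_
  convert hasSum_single k ?_ using 1
  · simp
  · intro j hj
    simp [sub_eq_zero, hj.symm]

theorem fc_congr {f g : ℝ → ℂ} (h : f =ᵐ[volume.restrict (Set.Ioc 0 (2*π))] g) (k : ℤ) :
    fc f k = fc g k := by
  have h0 : (0:ℝ) ≤ 2 * π := by positivity
  unfold fc
  rw [intervalIntegral.integral_of_le h0, intervalIntegral.integral_of_le h0]
  congr 1
  refine integral_congr_ae ?_
  filter_upwards [h] with x hx
  rw [hx]

theorem intervalIntegrable_mul_exp {f : ℝ → ℂ} (hf : IntervalIntegrable f volume 0 (2*π)) (k : ℤ) :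
    IntervalIntegrable (fun x : ℝ => f x * Complex.exp (-Complex.I * (k:ℂ) * (x:ℂ)))
      volume 0 (2*π) :=
  hf.mul_continuousOn (by fun_prop)

theorem fc_sub {f g : ℝ → ℂ} (hf : IntervalIntegrable f volume 0 (2*π))
    (hg : IntervalIntegrable g volume 0 (2*π)) (k : ℤ) :
    fc (fun x => f x - g x) k = fc f k - fc g k := by
  unfold fc
  simp_rw [sub_mul]
  rw [intervalIntegral.integral_sub (intervalIntegrable_mul_exp hf k)
    (intervalIntegrable_mul_exp hg k), mul_sub]

/-- The functional `φ ↦ ∫ h φ` on continuous functions on the circle vanishes if all Fourier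
coefficients of `h` do. -/
theorem integral_mul_continuousMap_eq_zero {h : ℝ → ℂ}
    (hh : IntervalIntegrable h volume 0 (2*π)) (h0 : ∀ k, fc h k = 0)
    (φ : C(AddCircle (2*π), ℂ)) :
    ∫ x in (0:ℝ)..(2*π), h x * φ (x : AddCircle (2*π)) = 0 := by
  have : Fact (0 < 2 * π) := ⟨Real.two_pi_pos⟩
  have hle : (0:ℝ) ≤ 2 * π := Real.two_pi_pos.le
  have hc : ∀ φ : C(AddCircle (2*π), ℂ), Continuous fun x : ℝ => φ (x : AddCircle (2*π)) :=
    fun φ => φ.continuous.comp (AddCircle.continuous_mk' _)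
  have hint : ∀ φ : C(AddCircle (2*π), ℂ),
      IntervalIntegrable (fun x : ℝ => h x * φ (x : AddCircle (2*π))) volume 0 (2*π) :=
    fun φ => hh.mul_continuousOn (hc φ).continuousOn
  let Λ : C(AddCircle (2*π), ℂ) →ₗ[ℂ] ℂ :=
    { toFun := fun φ => ∫ x in (0:ℝ)..(2*π), h x * φ (x : AddCircle (2*π))
      map_add' := fun φ₁ φ₂ => by
        rw [← intervalIntegral.integral_add (hint φ₁) (hint φ₂)]
        simp only [ContinuousMap.add_apply, mul_add]
      map_smul' := fun a φ => by
        rw [RingHom.id_apply, smul_eq_mul, ← intervalIntegral.integral_const_mul]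
        congr 1
        ext x
        simp only [ContinuousMap.smul_apply, smul_eq_mul]
        ring }
  let L : C(AddCircle (2*π), ℂ) →L[ℂ] ℂ :=
    Λ.mkContinuous (∫ x in (0:ℝ)..(2*π), ‖h x‖) fun φ => by
      change ‖∫ x in (0:ℝ)..(2*π), h x * φ (x : AddCircle (2*π))‖ ≤ _
      rw [← intervalIntegral.integral_mul_const]
      refine intervalIntegral.norm_integral_le_of_norm_le hle
        (ae_of_all _ fun x _ => ?_) (hh.norm.mul_const _)
      rw [norm_mul]
      exact mul_le_mul_of_nonneg_left (φ.norm_coe_le_norm _) (norm_nonneg _)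
  have hspan : Submodule.span ℂ (Set.range (@fourier (2*π))) ≤ LinearMap.ker L.toLinearMap := by
    rw [Submodule.span_le]
    rintro _ ⟨n, rfl⟩
    change ∫ x in (0:ℝ)..(2*π), h x * fourier n (x : AddCircle (2*π)) = 0
    have hn := h0 (-n)
    unfold fc at hn
    have hπ : (π : ℂ) ≠ 0 := by exact_mod_cast Real.pi_ne_zero
    have h1 : (1 / (2 * (π : ℂ))) ≠ 0 := by simp [hπ]
    rw [← (mul_eq_zero.mp hn).resolve_left h1]
    congr 1
    ext x
    rw [fourier_coe_apply]
    congr 2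
    push_cast
    field_simp
  have htop : (⊤ : Submodule ℂ C(AddCircle (2*π), ℂ)) ≤ LinearMap.ker L.toLinearMap := by
    rw [← span_fourier_closure_eq_top]
    exact Submodule.topologicalClosure_minimal _ hspan L.isClosed_ker
  exact htop (Submodule.mem_top (x := φ))

/-- An integrable function on `(0, 2π)` whose Fourier coefficients all vanish is zero a.e. -/
theorem ae_eq_zero_of_fc_eq_zero {h : ℝ → ℂ}
    (hh : IntervalIntegrable h volume 0 (2*π)) (h0 : ∀ k, fc h k = 0) :
    ∀ᵐ x ∂(volume.restrict (Set.Ioc 0 (2*π))), h x = 0 := by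
  have : Fact (0 < 2 * π) := ⟨Real.two_pi_pos⟩
  have hle : (0:ℝ) ≤ 2 * π := Real.two_pi_pos.le
  have hio : IntegrableOn h (Set.Ioo 0 (2*π)) :=
    ((intervalIntegrable_iff_integrableOn_Ioc_of_le hle).mp hh).mono_set Set.Ioo_subset_Ioc_self
  rw [← restrict_Ioo_eq_restrict_Ioc, ae_restrict_iff' measurableSet_Ioo]
  refine isOpen_Ioo.ae_eq_zero_of_integral_contDiff_smul_eq_zero hio.locallyIntegrableOn ?_
  intro g hg _ hsupp
  have hz : ∀ x ∉ Set.Ioo 0 (2*π), g x = 0 := fun x hx =>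
    image_eq_zero_of_notMem_tsupport fun hx' => hx (hsupp hx')
  let φ : C(AddCircle (2*π), ℂ) :=
    ⟨AddCircle.liftIco (2*π) 0 fun x => (g x : ℂ), AddCircle.liftIco_zero_continuous
      (by rw [hz 0 (by simp), hz (2*π) (by simp)])
      (Complex.continuous_ofReal.comp hg.continuous).continuousOn⟩
  have hφ : ∀ x ∈ Set.Ioo 0 (2*π), φ (x : AddCircle (2*π)) = g x := fun x hx => by
    exact AddCircle.liftIco_zero_coe_apply (f := fun x => (g x : ℂ)) (Set.Ioo_subset_Ico_self hx)
  have := integral_mul_continuousMap_eq_zero hh h0 φ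
  rw [intervalIntegral.integral_of_le hle, integral_Ioc_eq_integral_Ioo] at this
  rw [← setIntegral_eq_integral_of_forall_compl_eq_zero (s := Set.Ioo 0 (2*π))
    (fun x hx => by rw [hz x hx, zero_smul]), ← this]
  refine setIntegral_congr_fun measurableSet_Ioo fun x hx => ?_
  simp only [hφ x hx, Complex.real_smul, mul_comm]

theorem ae_eq_fourierSum {f : ℝ → ℂ} (hf : IntervalIntegrable f volume 0 (2*π))
    (hs : Summable fun k => ‖fc f k‖) :
    f =ᵐ[volume.restrict (Set.Ioc 0 (2*π))] fourierSum (fc f) := by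
  have hi : IntervalIntegrable (fourierSum (fc f)) volume 0 (2*π) :=
    (continuous_fourierSum hs).intervalIntegrable _ _
  have := ae_eq_zero_of_fc_eq_zero (hf.sub hi) fun k => by
    have := fc_sub hf hi k
    rw [fc_fourierSum hs, sub_self] at this
    exact this
  filter_upwards [this] with x hx
  exact sub_eq_zero.mp hx

theorem fc_mul {ψ f : ℝ → ℂ} (hψ : IntervalIntegrable ψ volume 0 (2*π))
    (hf : IntervalIntegrable f volume 0 (2*π)) (hs : Summable fun k => ‖fc f k‖) (k : ℤ) :
    HasSum (fun j => fc f j * fc ψ (k - j)) (fc (fun x => ψ x * f x) k) := by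
  have h := hasSum_fc_mul_fourierSum hψ hs k
  rwa [fc_congr (g := fun x => ψ x * f x)] at h
  filter_upwards [ae_eq_fourierSum hf hs] with x hx
  rw [hx]

/-- The symbol of the Hilbert transform. -/
def hilbertSymbol (k : ℤ) : ℂ := -Complex.I * (Int.sign k : ℂ)

theorem norm_hilbertSymbol_le (k : ℤ) : ‖hilbertSymbol k‖ ≤ 1 := by
  unfold hilbertSymbol
  rcases lt_trichotomy k 0 with h | h | h
  · simp [Int.sign_eq_neg_one_of_neg h]
  · simp [h]
  · simp [Int.sign_eq_one_of_pos h]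

theorem HT_eq_fourierSum (f : ℝ → ℂ) : HT f = fourierSum fun k => hilbertSymbol k * fc f k := rfl

theorem summable_norm_hilbertSymbol_mul {c : ℤ → ℂ} (hc : Summable fun k => ‖c k‖) :
    Summable fun k => ‖hilbertSymbol k * c k‖ :=
  hc.of_nonneg_of_le (fun _ => norm_nonneg _) fun k => by
    rw [norm_mul]
    exact mul_le_of_le_one_left (norm_nonneg _) (norm_hilbertSymbol_le k)

theorem norm_hilbertSymbol_sub_le (k j : ℤ) : ‖hilbertSymbol k - hilbertSymbol j‖ ≤ 2 :=
  (norm_sub_le _ _).trans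
    (by linarith [norm_hilbertSymbol_le k, norm_hilbertSymbol_le j])

/-- The commutator only sees pairs of frequencies of different sign, for which
`|k| ≤ |k - j|`. -/
theorem rpow_mul_norm_hilbertSymbol_sub_le {s : ℝ} (hs : 0 < s) (k j : ℤ) :
    |(k:ℝ)| ^ s * ‖hilbertSymbol k - hilbertSymbol j‖ ≤ 2 * |((k - j : ℤ):ℝ)| ^ s := by
  rcases eq_or_ne (Int.sign k) (Int.sign j) with h | h
  · rw [hilbertSymbol, hilbertSymbol, h, sub_self, norm_zero, mul_zero]
    positivity
  · have hkj : |k| ≤ |k - j| := by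
      rcases lt_trichotomy k 0 with hk | hk | hk <;> rcases lt_trichotomy j 0 with hj | hj | hj
      all_goals
        first
        | (exfalso; apply h; simp [Int.sign_eq_neg_one_of_neg, Int.sign_eq_one_of_pos, *]; done)
        | (clear h; rcases abs_cases k with h1 | h1 <;> rcases abs_cases (k - j) with h2 | h2 <;>
            omega)
    have hkj' : |(k:ℝ)| ≤ |((k - j : ℤ):ℝ)| := by exact_mod_cast hkj
    have h1 := Real.rpow_le_rpow (abs_nonneg _) hkj' hs.le
    have h2 : 0 ≤ |(k:ℝ)| ^ s := by positivity
    nlinarith [norm_hilbertSymbol_sub_le k j, norm_nonneg (hilbertSymbol k - hilbertSymbol j)]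

theorem rpow_two_mul_mul_sq (x s y : ℝ) :
    |x| ^ (2 * s) * y ^ 2 = (|x| ^ s * y) ^ 2 := by
  rw [mul_pow, mul_comm 2 s, Real.rpow_mul (abs_nonneg _), Real.rpow_two]

theorem sq_norm_fc_le_hnormSq {s : ℝ} {f : ℝ → ℂ}
    (hf : Summable fun k : ℤ => |(k:ℝ)| ^ (2*s) * ‖fc f k‖^2) (hs : 0 ≤ s) (k : ℤ) :
    ‖fc f k‖ ^ 2 ≤ hnormSq s f := by
  have hnn : ∀ k : ℤ, 0 ≤ |(k:ℝ)| ^ (2*s) * ‖fc f k‖^2 := fun k => by positivity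
  unfold hnormSq
  rcases eq_or_ne k 0 with rfl | hk
  · linarith [tsum_nonneg (L := .unconditional ℤ) hnn]
  · have h1 : (1:ℝ) ≤ |(k:ℝ)| := by exact_mod_cast Int.one_le_abs hk
    have h2 : 1 ≤ |(k:ℝ)| ^ (2*s) := Real.one_le_rpow h1 (by linarith)
    have h3 := hf.le_tsum k fun j _ => hnn j
    nlinarith [sq_nonneg ‖fc f k‖, sq_nonneg ‖fc f 0‖]

theorem hnormSq_nonneg (s : ℝ) (f : ℝ → ℂ) : 0 ≤ hnormSq s f :=
  add_nonneg (tsum_nonneg fun k => by positivity) (sq_nonneg _)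

theorem summable_norm_fc_mul {ψ f : ℝ → ℂ} (hψ : IntervalIntegrable ψ volume 0 (2*π))
    (hf : IntervalIntegrable f volume 0 (2*π)) (ha : Summable fun k => ‖fc ψ k‖)
    (hb : Summable fun k => ‖fc f k‖) : Summable fun k => ‖fc (fun x => ψ x * f x) k‖ := by
  have hn : ∀ g : ℝ → ℂ, ∀ k, 0 ≤ ‖fc g k‖ := fun g k => norm_nonneg _
  refine (hasSum_tsum_sub_mul (hn ψ) (hn f) ha hb).summable.of_nonneg_of_le
    (fun _ => norm_nonneg _) fun k => ?_
  have := summable_sub_mul (hn ψ) (hn f) ha hb k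
  rw [← (fc_mul hψ hf hb k).tsum_eq]
  refine tsum_of_norm_bounded this.hasSum fun j => ?_
  rw [norm_mul, mul_comm]

/-- The Fourier coefficients of the commutator. -/
theorem hasSum_fc_commHT {ψ f : ℝ → ℂ} (hψ : IntervalIntegrable ψ volume 0 (2*π))
    (hf : IntervalIntegrable f volume 0 (2*π)) (ha : Summable fun k => ‖fc ψ k‖)
    (hb : Summable fun k => ‖fc f k‖) (k : ℤ) :
    HasSum (fun j => (hilbertSymbol k - hilbertSymbol j) * (fc ψ (k - j) * fc f j))
      (fc (commHT ψ f) k) := by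
  have hd := summable_norm_hilbertSymbol_mul (summable_norm_fc_mul hψ hf ha hb)
  have hb' := summable_norm_hilbertSymbol_mul hb
  have e : fc (commHT ψ f) k = hilbertSymbol k * fc (fun x => ψ x * f x) k
      - fc (fun x => ψ x * fourierSum (fun j => hilbertSymbol j * fc f j) x) k := by
    rw [← fc_fourierSum hd k]
    exact fc_sub ((continuous_fourierSum hd).intervalIntegrable _ _)
      (intervalIntegrable_mul_fourierSum hψ hb') k
  rw [e]
  refine (((fc_mul hψ hf hb k).mul_left _).sub (hasSum_fc_mul_fourierSum hψ hb' k)).congr_fun ?_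
  intro j
  ring

/-- the commutator `[ℋ, ψ]` is bounded from H¹ to H^s for
`s > 1/2` (Lemma 3.10). -/
theorem commutator_H1_bound (s : ℝ) (hs : 1/2 < s) :
    ∃ C : ℝ, 0 < C ∧ ∀ ψ : ℝ → ℂ, MemH s ψ → ∀ f : ℝ → ℂ, MemH 1 f →
      MemH s (commHT ψ f) ∧
      hnorm s (commHT ψ f) ≤ C * hnorm 1 f * hnorm s ψ := by
  obtain ⟨_, -, hW'⟩ := exists_sq_tsum_norm_le hs
  obtain ⟨W, hW0, hW⟩ := exists_sq_tsum_norm_le (s := 1) (by norm_num)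
  have hs0 : 0 < s := by linarith
  refine ⟨√(8 * W), by positivity, ?_⟩
  rintro ψ ⟨ψper, hψ, ψsum⟩ f ⟨-, hf, fsum⟩
  have ha := (hW' _ ψsum).1
  obtain ⟨hb, hbW⟩ := hW _ fsum
  change _ ≤ W * hnormSq 1 f at hbW
  set B := ∑' k, ‖fc f k‖
  have hcoef := hasSum_fc_commHT hψ hf ha hb
  obtain ⟨hY, hYsum, hYle⟩ := young_conv (u := fun k : ℤ => |(k:ℝ)| ^ s * ‖fc ψ k‖)
    (v := fun k => ‖fc f k‖) (fun k => by positivity) (fun k => norm_nonneg _)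
    (by simpa only [rpow_two_mul_mul_sq] using ψsum) hb
  have hpt : ∀ k : ℤ, |(k:ℝ)| ^ (2*s) * ‖fc (commHT ψ f) k‖ ^ 2 ≤
      4 * (∑' j, |((k - j : ℤ):ℝ)| ^ s * ‖fc ψ (k - j)‖ * ‖fc f j‖) ^ 2 := by
    intro k
    have h1 := (hcoef k).mul_left ((|(k:ℝ)| ^ s : ℝ) : ℂ)
    have h2 : ‖((|(k:ℝ)| ^ s : ℝ) : ℂ) * fc (commHT ψ f) k‖ ≤
        2 * ∑' j, |((k - j : ℤ):ℝ)| ^ s * ‖fc ψ (k - j)‖ * ‖fc f j‖ := by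
      rw [← h1.tsum_eq]
      refine tsum_of_norm_bounded ((hY k).hasSum.mul_left 2) fun j => ?_
      rw [norm_mul, norm_mul, norm_mul, Complex.norm_real, Real.norm_of_nonneg (by positivity),
        ← mul_assoc]
      calc _ ≤ 2 * |((k - j : ℤ):ℝ)| ^ s * (‖fc ψ (k - j)‖ * ‖fc f j‖) :=
            mul_le_mul_of_nonneg_right (rpow_mul_norm_hilbertSymbol_sub_le hs0 k j)
              (by positivity)
        _ = _ := by ring
    rw [norm_mul, Complex.norm_real, Real.norm_of_nonneg (by positivity)] at h2
    rw [rpow_two_mul_mul_sq]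
    calc _ ≤ _ := pow_le_pow_left₀ (by positivity) h2 2
      _ = _ := by ring
  have hgsum : Summable fun k : ℤ => |(k:ℝ)| ^ (2*s) * ‖fc (commHT ψ f) k‖ ^ 2 :=
    (hYsum.mul_left 4).of_nonneg_of_le (fun k => by positivity) hpt
  refine ⟨⟨?_, ?_, hgsum⟩, ?_⟩
  · intro x
    simp only [commHT, HT_eq_fourierSum]
    rw [periodic_fourierSum, periodic_fourierSum, ψper]
  · exact ((continuous_fourierSum (summable_norm_hilbertSymbol_mul
      (summable_norm_fc_mul hψ hf ha hb))).intervalIntegrable _ _).sub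
      (intervalIntegrable_mul_fourierSum hψ (summable_norm_hilbertSymbol_mul hb))
  have hNψ := hnormSq_nonneg s ψ
  have hzero : ‖fc (commHT ψ f) 0‖ ≤ 2 * √(hnormSq s ψ) * B := by
    rw [← (hcoef 0).tsum_eq]
    refine tsum_of_norm_bounded (hb.hasSum.mul_left _) fun j => ?_
    rw [norm_mul, norm_mul, ← mul_assoc]
    have h1 : ‖fc ψ (0 - j)‖ ≤ √(hnormSq s ψ) :=
      Real.le_sqrt_of_sq_le (sq_norm_fc_le_hnormSq ψsum hs0.le _)
    have h2 := norm_hilbertSymbol_sub_le 0 j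
    gcongr
  have hzero2 : ‖fc (commHT ψ f) 0‖ ^ 2 ≤ 4 * hnormSq s ψ * B ^ 2 := by
    calc _ ≤ _ := pow_le_pow_left₀ (norm_nonneg _) hzero 2
      _ = _ := by rw [mul_pow, mul_pow, Real.sq_sqrt hNψ]; ring
  have hmain : ∑' k : ℤ, |(k:ℝ)| ^ (2*s) * ‖fc (commHT ψ f) k‖ ^ 2 ≤
      4 * (hnormSq s ψ * B ^ 2) := by
    refine (hgsum.tsum_le_tsum hpt (hYsum.mul_left 4)).trans ?_
    rw [tsum_mul_left]
    refine mul_le_mul_of_nonneg_left (hYle.trans ?_) (by norm_num)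
    refine mul_le_mul_of_nonneg_right ?_ (sq_nonneg _)
    simp only [← rpow_two_mul_mul_sq]
    exact le_add_of_nonneg_right (sq_nonneg _)
  have hfinal : hnormSq s (commHT ψ f) ≤ 8 * W * hnormSq 1 f * hnormSq s ψ := by
    have := mul_le_mul_of_nonneg_left hbW hNψ
    calc hnormSq s (commHT ψ f) ≤ 4 * (hnormSq s ψ * B ^ 2) + 4 * hnormSq s ψ * B ^ 2 :=
          add_le_add hmain hzero2
      _ ≤ _ := by linarith
  unfold hnorm
  rw [← Real.sqrt_mul (by positivity), ← Real.sqrt_mul (by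
    have := hnormSq_nonneg 1 f
    positivity)]
  exact Real.sqrt_le_sqrt hfinal

end HeleShaw
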